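/- Let A = (Q, Σ, δ) be a strongly connected partial DFA and let T be one of its collecting trees. Then A is synchronizing if and only if the collecting automaton A^{C(T)} = (Q, Σ ∪ {γ}, δ^{C(T)}) is synchronizing. -/

import Mathlib

open scoped Classical

section Defs

variable {Q A : Type*}

/-- Action of a word in a partial DFA with transition function `δ`
(`none` means the undefined value ⊥). -/
def stepWord (δ : Q → A → Option Q) : Q → List A → Option Q
  | q, [] => some q
  | q, a :: w => (δ q a).bind (fun p => stepWord δ p w)

/-- The image `δ(S, w)` of a set of states under the action of a word. -/
def img (δ : Q → A → Option Q) (S : Set Q) (w : List A) : Set Q :=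
  {p | ∃ q ∈ S, stepWord δ q w = some p}

/-- The inseparability equivalence `p ≡ q`. -/
def Insep (δ : Q → A → Option Q) (p q : Q) : Prop :=
  ∀ u : List A, (stepWord δ p u).isSome ↔ (stepWord δ q u).isSome

/-- `κ(S)`: the number of inseparability classes intersecting `S`. -/
noncomputable def kappa (δ : Q → A → Option Q) (S : Set Q) : ℕ :=
  {C : Set Q | ∃ p ∈ S, C = {q | Insep δ p q}}.ncard

def StronglyConnected (δ : Q → A → Option Q) : Prop :=
  ∀ p q : Q, ∃ w : List A, stepWord δ p w = some q

/-- The transition function of the fixing automaton `A^F`. -/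
def fixDelta (δ : Q → A → Option Q) (q : Q) (a : A) : Q := (δ q a).getD q

/-- Action of a word in a complete DFA. -/
def stepWordC (δc : Q → A → Q) (q : Q) (w : List A) : Q := w.foldl δc q

/-- The image of a set of states under the action of a word in a complete DFA. -/
def imgC (δc : Q → A → Q) (S : Set Q) (w : List A) : Set Q :=
  (fun q => stepWordC δc q w) '' S

end Defs

variable {Q A : Type*}

/-- The transition function of the collecting automaton `A^{C(T)}`, a complete DFA over
the alphabet `Option A`, where `none` plays the role of the fresh letter `γ`.
The collecting tree `T` is encoded by a root state `r` (its class being the root class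
`[r]`) and a function `τ` choosing, for each state `q`, the letter labeling the unique
edge of `T` leaving the class `[q]`. On letters `some a` it acts as the fixing automaton;
the letter `γ = none` acts on `q ∉ [r]` by the letter `τ q`, and as the identity on `[r]`. -/
noncomputable def collectDelta (δ : Q → A → Option Q) (r : Q) (τ : Q → A) :
    Q → Option A → Q
  | q, some a => fixDelta δ q a
  | q, none => if Insep δ q r then q else (δ q (τ q)).getD q

/-- `τ` (together with the root `r`) encodes a collecting tree: it is constant on
inseparability classes, defined outside the root class, and iterating the `γ`-step from
any state eventually reaches the root class (the tree is directed toward `[r]`). -/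
def IsCollectingTree (δ : Q → A → Option Q) (r : Q) (τ : Q → A) : Prop :=
  (∀ p q : Q, Insep δ p q → τ p = τ q) ∧
  (∀ q : Q, ¬ Insep δ q r → (δ q (τ q)).isSome) ∧
  (∀ q : Q, ∃ k : ℕ, Insep δ ((fun p => collectDelta δ r τ p none)^[k] q) r)

theorem stepWord_append (δ : Q → A → Option Q) (q : Q) (u v : List A) :
    stepWord δ q (u ++ v) = (stepWord δ q u).bind (fun p => stepWord δ p v) := by
  induction u generalizing q with
  | nil => rfl
  | cons a u ih =>
    simp only [List.cons_append, stepWord]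
    cases δ q a with
    | none => rfl
    | some p => exact ih p

theorem img_append (δ : Q → A → Option Q) (S : Set Q) (u v : List A) :
    img δ S (u ++ v) = img δ (img δ S u) v := by
  ext p
  simp only [img, stepWord_append, Set.mem_ofPred_eq, Option.bind_eq_some_iff]
  constructor
  · rintro ⟨q, hq, s, hs, hp⟩
    exact ⟨s, ⟨q, hq, hs⟩, hp⟩
  · rintro ⟨s, ⟨q, hq, hs⟩, hp⟩
    exact ⟨q, hq, s, hs, hp⟩

/-- Transitions by a common letter preserve inseparability. -/
theorem Insep.step {δ : Q → A → Option Q} {p q p' q' : Q} {a : A} (h : Insep δ p q)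
    (hp : δ p a = some p') (hq : δ q a = some q') : Insep δ p' q' := by
  intro u
  have hu := h (a :: u)
  simpa only [stepWord, hp, hq, Option.bind_some] using hu

theorem Insep.isSome_iff {δ : Q → A → Option Q} {p q : Q} (h : Insep δ p q) (a : A) :
    (δ p a).isSome ↔ (δ q a).isSome := by
  have ha := h [a]
  cases hp : δ p a <;> cases hq : δ q a <;> simp_all [stepWord]

theorem Insep.symm {δ : Q → A → Option Q} {p q : Q} (h : Insep δ p q) : Insep δ q p :=
  fun u => (h u).symm

theorem Insep.trans {δ : Q → A → Option Q} {p q s : Q} (h : Insep δ p q)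
    (h' : Insep δ q s) : Insep δ p s :=
  fun u => (h u).trans (h' u)

/-- A word separating two states of a finite set strictly shrinks that set. -/
theorem ncard_img_lt [Finite Q] (δ : Q → A → Option Q) {S : Set Q} {p : Q} (hp : p ∈ S)
    {u : List A} (hu : stepWord δ p u = none) : (img δ S u).ncard < S.ncard := by
  have hsub : img δ S u ⊆ (fun q => (stepWord δ q u).getD q) '' (S \ {p}) := by
    rintro s ⟨q, hq, hs⟩
    refine ⟨q, ⟨hq, ?_⟩, by simp [hs]⟩
    rintro rfl
    simp [hu] at hs
  calc (img δ S u).ncard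
      ≤ ((fun q => (stepWord δ q u).getD q) '' (S \ {p})).ncard :=
        Set.ncard_le_ncard hsub (Set.toFinite _)
    _ ≤ (S \ {p}).ncard := Set.ncard_image_le (Set.toFinite _)
    _ < S.ncard := Set.ncard_sdiff_singleton_lt_of_mem hp (Set.toFinite _)

/-- Every nonempty set of states has a nonempty image inside a single inseparability class. -/
theorem exists_img_pairwise_insep [Finite Q] (δ : Q → A → Option Q) (S : Set Q)
    (hS : S.Nonempty) :
    ∃ w : List A, (img δ S w).Nonempty ∧ ∀ p ∈ img δ S w, ∀ q ∈ img δ S w, Insep δ p q := by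
  induction hn : S.ncard using Nat.strong_induction_on generalizing S with
  | _ n ih =>
    have descend : ∀ p ∈ S, ∀ q ∈ S, ∀ u : List A,
        stepWord δ p u = none → (stepWord δ q u).isSome →
        ∃ w : List A, (img δ S w).Nonempty ∧
          ∀ p ∈ img δ S w, ∀ q ∈ img δ S w, Insep δ p q := by
      intro p hp q hq u hpu hqu
      obtain ⟨s, hs⟩ := Option.isSome_iff_exists.mp hqu
      obtain ⟨w, hw⟩ := ih _ (hn ▸ ncard_img_lt δ hp hpu) (img δ S u) ⟨s, q, hq, hs⟩ rfl
      exact ⟨u ++ w, by rwa [img_append]⟩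
    by_cases h : ∀ p ∈ S, ∀ q ∈ S, Insep δ p q
    · have himg : img δ S [] = S := by
        ext p
        simp [img, stepWord]
      exact ⟨[], by rw [himg]; exact ⟨hS, h⟩⟩
    · simp only [Insep, not_forall] at h
      obtain ⟨p, hp, q, hq, u, hu⟩ := h
      cases hpu : stepWord δ p u with
      | none =>
        refine descend p hp q hq u hpu ?_
        by_contra hqu
        simp [hpu, hqu] at hu
      | some s =>
        refine descend q hq p hp u ?_ (by simp [hpu])
        by_contra hqu
        exact hu (by simp [hpu, Option.isSome_iff_ne_none, hqu])

/-- On a single inseparability class, each letter of the collecting automaton acts either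
trivially or as a letter of the partial automaton defined on the whole class. -/
theorem collectDelta_eq_or {δ : Q → A → Option Q} {r : Q} {τ : Q → A}
    (hT : IsCollectingTree δ r τ) (p : Q) (c : Option A) :
    (∀ q, Insep δ p q → collectDelta δ r τ q c = q) ∨
    ∃ a : A, ∀ q, Insep δ p q → δ q a = some (collectDelta δ r τ q c) := by
  cases c with
  | some a =>
    by_cases ha : (δ p a).isSome
    · refine Or.inr ⟨a, fun q hq => ?_⟩
      obtain ⟨s, hs⟩ := Option.isSome_iff_exists.mp ((hq.isSome_iff a).mp ha)
      simp [collectDelta, fixDelta, hs]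
    · refine Or.inl fun q hq => ?_
      have hs : δ q a = none := by simpa using mt (hq.isSome_iff a).mpr ha
      simp [collectDelta, fixDelta, hs]
  | none =>
    by_cases hr : Insep δ p r
    · exact Or.inl fun q hq => if_pos (hq.symm.trans hr)
    · refine Or.inr ⟨τ p, fun q hq => ?_⟩
      have hqr : ¬ Insep δ q r := fun h => hr (hq.trans h)
      obtain ⟨s, hs⟩ := Option.isSome_iff_exists.mp (hT.2.1 q hqr)
      rw [hT.1 p q hq]
      simp [collectDelta, hqr, hs]

/-- On a single inseparability class, each word of the collecting automaton acts as some
word of the partial automaton. -/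
theorem exists_stepWord_eq_stepWordC {δ : Q → A → Option Q} {r : Q} {τ : Q → A}
    (hT : IsCollectingTree δ r τ) (w : List (Option A)) (p : Q) :
    ∃ u : List A, ∀ q, Insep δ p q →
      stepWord δ q u = some (stepWordC (collectDelta δ r τ) q w) := by
  induction w generalizing p with
  | nil => exact ⟨[], fun q _ => rfl⟩
  | cons c w ih =>
    rcases collectDelta_eq_or hT p c with h | ⟨a, h⟩
    · obtain ⟨u, hu⟩ := ih p
      refine ⟨u, fun q hq => ?_⟩
      rw [hu q hq]
      simp only [stepWordC, List.foldl_cons, h q hq]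
    · have hp := h p fun _ => Iff.rfl
      obtain ⟨u, hu⟩ := ih (collectDelta δ r τ p c)
      refine ⟨a :: u, fun q hq => ?_⟩
      simp only [stepWord, h q hq, Option.bind_some]
      exact hu _ (hq.step hp (h q hq))

/-- Where a word is defined, the collecting automaton acts on it as the partial automaton. -/
theorem stepWordC_map_some {δ : Q → A → Option Q} {r : Q} {τ : Q → A} {u : List A} {q p : Q}
    (h : stepWord δ q u = some p) :
    stepWordC (collectDelta δ r τ) q (u.map some) = p := by
  induction u generalizing q with
  | nil => simpa [stepWord, stepWordC] using h
  | cons a u ih =>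
    simp only [stepWord, Option.bind_eq_some_iff] at h
    obtain ⟨s, hs, hp⟩ := h
    have hstep : collectDelta δ r τ q (some a) = s := by simp [collectDelta, fixDelta, hs]
    simpa only [stepWordC, List.map_cons, List.foldl_cons, hstep] using ih hp

theorem stepWordC_replicate {B : Type*} (d : Q → B → Q) (b : B) (k : ℕ) (q : Q) :
    stepWordC d q (List.replicate k b) = (fun p => d p b)^[k] q := by
  induction k generalizing q with
  | zero => rfl
  | succ k ih => exact ih (d q b)

/-- A power of the collecting letter sends all states to the root class. -/
theorem exists_iterate_collect [Finite Q] {δ : Q → A → Option Q} {r : Q} {τ : Q → A}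
    (hT : IsCollectingTree δ r τ) :
    ∃ k : ℕ, ∀ q, Insep δ ((fun p => collectDelta δ r τ p none)^[k] q) r := by
  have hev : ∀ q, ∀ᶠ k in Filter.atTop,
      Insep δ ((fun p => collectDelta δ r τ p none)^[k] q) r := by
    intro q
    obtain ⟨k, hk⟩ := hT.2.2 q
    refine Filter.eventually_atTop.mpr ⟨k, fun m hm => ?_⟩
    induction m, hm using Nat.le_induction with
    | base => exact hk
    | succ m _ ih =>
      rw [Function.iterate_succ_apply']
      have hfix : ∀ p, Insep δ p r → collectDelta δ r τ p none = p := fun p hp => if_pos hp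
      rwa [hfix _ ih]
  exact (Filter.eventually_all.mpr hev).exists

/-- A strongly connected partial DFA `A` is synchronizing if and only if
its collecting automaton `A^{C(T)}` is synchronizing. -/
theorem stmt9 {Q A : Type*} [Fintype Q] (δ : Q → A → Option Q)
    (hsc : StronglyConnected δ) (r : Q) (τ : Q → A) (hT : IsCollectingTree δ r τ) :
    (∃ w : List A, (img δ Set.univ w).ncard = 1) ↔
    (∃ w : List (Option A), (imgC (collectDelta δ r τ) Set.univ w).ncard = 1) := by
  constructor
  · rintro ⟨w, hw⟩
    obtain ⟨s, hs⟩ := Set.ncard_eq_one.mp hw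
    obtain ⟨q, -, hq⟩ : s ∈ img δ Set.univ w := hs ▸ rfl
    obtain ⟨u, hu⟩ := hsc r q
    obtain ⟨k, hk⟩ := exists_iterate_collect hT
    have hr : stepWord δ r (u ++ w) = some s := by simp [stepWord_append, hu, hq]
    have hreset : ∀ p, Insep δ p r → stepWord δ p (u ++ w) = some s := by
      intro p hp
      obtain ⟨t, ht⟩ := Option.isSome_iff_exists.mp ((hp (u ++ w)).mpr (by simp [hr]))
      have hmem : t ∈ img δ Set.univ w := by
        rw [stepWord_append, Option.bind_eq_some_iff] at ht
        obtain ⟨p', -, hp'⟩ := ht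
        exact ⟨p', Set.mem_univ _, hp'⟩
      rw [hs, Set.mem_singleton_iff] at hmem
      rw [ht, hmem]
    refine ⟨List.replicate k none ++ (u ++ w).map some, Set.ncard_eq_one.mpr ⟨s, ?_⟩⟩
    have hconst : ∀ p, stepWordC (collectDelta δ r τ) p
        (List.replicate k none ++ (u ++ w).map some) = s := by
      intro p
      have h := stepWordC_map_some (r := r) (τ := τ) (hreset _ (hk p))
      rw [← stepWordC_replicate] at h
      simpa only [stepWordC, List.foldl_append] using h
    simp only [imgC, hconst]
    exact Set.Nonempty.image_const ⟨r, Set.mem_univ r⟩ s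
  · rintro ⟨w, hw⟩
    obtain ⟨s, hs⟩ := Set.ncard_eq_one.mp hw
    obtain ⟨v, ⟨p, hp⟩, hv⟩ := exists_img_pairwise_insep δ Set.univ ⟨r, Set.mem_univ r⟩
    obtain ⟨u, hu⟩ := exists_stepWord_eq_stepWordC hT w p
    have hsu : ∀ q ∈ img δ Set.univ v, stepWord δ q u = some s := by
      intro q hq
      have hmem : stepWordC (collectDelta δ r τ) q w ∈
          imgC (collectDelta δ r τ) Set.univ w := ⟨q, Set.mem_univ q, rfl⟩
      rw [hs, Set.mem_singleton_iff] at hmem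
      rw [hu q (hv p hp q hq), hmem]
    refine ⟨v ++ u, Set.ncard_eq_one.mpr ⟨s, ?_⟩⟩
    rw [img_append]
    ext t
    constructor
    · rintro ⟨q, hq, ht⟩
      rw [hsu q hq] at ht
      exact (Option.some.inj ht).symm
    · rintro rfl
      exact ⟨p, hp, hsu p hp⟩
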